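/- arXiv:2211.15862 — 2 statements merged into one kernel-verified Lean document; each statement's English description precedes it below -/
import Mathlib

section
/- For n ≥ 3 (or more generally except (n,r) = (2,2)), the r-th discriminant-resultant has the bracket polynomial expression DR_{n,r} = Σ_{I ⊔ J = [n], |I| = r} ( ∏_{j ∈ J, i ∈ [n]∖{j}} [α_i, α_j] · ∏_{i ∈ I, k ∈ [n−2]} [β_k, α_i] ), where f_n = ∏_{i=1}^n (α_{i,0}x − α_{i,1}y) and f_{n−2} = ∏_{k=1}^{n−2} (β_{k,0}x − β_{k,1}y). -/
open Polynomial Finset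

/-- The resultant of two binary forms of (formal) degrees `d` and `e`, given by their
dehomogenizations. -/
noncomputable def res {k : Type*} [CommRing k] (d e : ℕ) (p q : Polynomial k) : k :=
  (-1 : k) ^ (d * e) *
    Matrix.det (Matrix.of fun i j : Fin (d + e) =>
      if (i : ℕ) < e then
        (if (i : ℕ) ≤ (j : ℕ) ∧ (j : ℕ) ≤ d + (i : ℕ) then
          p.coeff (d + (i : ℕ) - (j : ℕ)) else 0)
      else
        (if (i : ℕ) - e ≤ (j : ℕ) ∧ (j : ℕ) ≤ (i : ℕ) then
          q.coeff ((i : ℕ) - (j : ℕ)) else 0))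

/-- The bracket `[u,v] = u₀v₁ - v₀u₁`. -/
def bracket {k : Type*} [CommRing k] (u v : Fin 2 → k) : k := u 0 * v 1 - v 0 * u 1

/-- The numerator of the discriminant-resultant generating polynomial:
`res(f_n, x ∂ₓ f_n + t·x·y·f_{n-2})`, computed over `k[t]`. -/
noncomputable def DRnum {k : Type*} [CommRing k] (n : ℕ) (p q : Polynomial k) :
    Polynomial k :=
  res n n (p.map (Polynomial.C : k →+* Polynomial k))
    (Polynomial.X * (Polynomial.derivative p).map (Polynomial.C : k →+* Polynomial k) +
      Polynomial.C (Polynomial.X : Polynomial k) * Polynomial.X *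
        (q.map (Polynomial.C : k →+* Polynomial k)))

/-- The `r`-th discriminant-resultant `DR_{n,r}`: the coefficient of `t^r` in
`res(f_n, x ∂ₓ f_n + t·x·y·f_{n-2}) / (a₀ aₙ)`. -/
noncomputable def DR {k : Type*} [Field k] (n r : ℕ) (p q : Polynomial k) : k :=
  (DRnum n p q).coeff r / (p.coeff 0 * p.coeff n)

theorem res_eq_resultant {R : Type*} [CommRing R] (d e : ℕ) (p q : R[X]) :
    res d e p q = (-1) ^ (d * e) * resultant p q d e := by
  rw [res, resultant, ← Matrix.det_transpose (sylvester p q d e),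
    ← Matrix.det_submatrix_equiv_self Fin.revPerm]
  congr 2
  ext i j
  induction i using Fin.addCases with
  | left i =>
    have hi := i.isLt
    have hj := j.isLt
    simp only [sylvester, Matrix.submatrix_apply, Matrix.transpose_apply, Matrix.of_apply,
      Fin.revPerm_apply, Fin.val_rev, Fin.val_castAdd, Fin.addCases_left, Set.mem_Icc]
    rw [if_neg (by omega)]
    refine if_congr (by omega) (congrArg _ (by omega)) rfl
  | right i =>
    have hi := i.isLt
    have hj := j.isLt
    simp only [sylvester, Matrix.submatrix_apply, Matrix.transpose_apply, Matrix.of_apply,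
      Fin.revPerm_apply, Fin.val_rev, Fin.val_natAdd, Fin.addCases_right, Set.mem_Icc]
    rw [if_pos (by omega)]
    by_cases h : (i : ℕ) ≤ j ∧ (j : ℕ) ≤ i + d
    · rw [if_pos (by omega), if_pos h]
      exact congrArg _ (by omega)
    · rw [if_neg (by omega), if_neg h]

/-- The resultant of a product of linear forms with `g` is the product of the homogenized values
of `g` at the roots. -/
theorem resultant_prod_C_mul_X_sub_C {R : Type*} [CommRing R] [IsDomain R] {n : ℕ}
    (a ξ : Fin n → R) (ha : ∀ i, a i ≠ 0) (g : R[X]) (e : ℕ) (hg : g.natDegree ≤ e) :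
    resultant (∏ i, C (a i) * (X - C (ξ i))) g n e = ∏ i, a i ^ e * g.eval (ξ i) := by
  have hdeg (i : Fin n) : (C (a i) * (X - C (ξ i))).natDegree = 1 := by
    rw [natDegree_C_mul (ha i), natDegree_X_sub_C]
  have hlead : ∏ i, (C (a i) * (X - C (ξ i))).leadingCoeff ≠ 0 :=
    Finset.prod_ne_zero_iff.mpr fun i _ => by simp [ha i]
  have hprod : (∏ i, C (a i) * (X - C (ξ i))).natDegree = n := by
    rw [natDegree_prod' _ _ hlead]
    simp [hdeg]
  have h := resultant_prod_left Finset.univ (fun i => C (a i) * (X - C (ξ i))) g e hlead hg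
  rw [hprod] at h
  rw [h]
  refine Finset.prod_congr rfl fun i _ => ?_
  rw [hdeg, resultant_C_mul_left, resultant_X_sub_C_left _ _ _ hg]

/-- Homogenized evaluation of a product of linear forms as a product of brackets. -/
theorem pow_card_mul_eval_prod {k ι : Type*} [Field k] (s : Finset ι) (γ : ι → Fin 2 → k)
    (v : Fin 2 → k) (hv : v 0 ≠ 0) :
    v 0 ^ s.card * (∏ i ∈ s, (C (γ i 0) * X - C (γ i 1))).eval (v 1 / v 0) =
      ∏ i ∈ s, bracket (γ i) v := by
  rw [eval_prod, ← Finset.prod_const, ← Finset.prod_mul_distrib]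
  refine Finset.prod_congr rfl fun i _ => ?_
  simp only [bracket, eval_sub, eval_mul, eval_C, eval_X]
  field_simp

theorem eval_derivative_prod_linear {k ι : Type*} [Field k] [DecidableEq ι] (s : Finset ι)
    (γ : ι → Fin 2 → k) {j : ι} (hj : j ∈ s) (h0 : γ j 0 ≠ 0) :
    (derivative (∏ i ∈ s, (C (γ i 0) * X - C (γ i 1)))).eval (γ j 1 / γ j 0) =
      γ j 0 * (∏ i ∈ s.erase j, (C (γ i 0) * X - C (γ i 1))).eval (γ j 1 / γ j 0) := by
  rw [← Finset.mul_prod_erase s _ hj, derivative_mul]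
  simp [mul_div_cancel₀ _ h0]

theorem coeff_prod_C_add_X_mul_C {R ι : Type*} [CommRing R] [Fintype ι] [DecidableEq ι]
    (a b : ι → R) (r : ℕ) :
    (∏ i, (C (a i) + X * C (b i))).coeff r =
      ∑ I ∈ Finset.powersetCard r (Finset.univ : Finset ι), (∏ j ∈ Iᶜ, a j) * ∏ i ∈ I, b i := by
  have h (I : Finset ι) : ((∏ i ∈ I, X * C (b i)) * ∏ j ∈ Iᶜ, C (a j)).coeff r =
      if I.card = r then (∏ j ∈ Iᶜ, a j) * ∏ i ∈ I, b i else 0 := by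
    rw [Finset.prod_mul_distrib, Finset.prod_const, ← map_prod, ← map_prod, mul_assoc, ← C_mul,
      coeff_X_pow_mul', coeff_C, mul_comm (∏ i ∈ I, b i)]
    split_ifs <;> first | rfl | omega
  simp_rw [add_comm (C _)]
  rw [Fintype.prod_add, finsetSum_coeff]
  simp_rw [h]
  rw [← Finset.sum_filter]
  refine Finset.sum_congr ?_ fun _ _ => rfl
  ext I
  simp [Finset.mem_powersetCard]

/-- Bracket polynomial expression for the discriminant-resultants: for `(n,r) ≠ (2,2)`,
`DR_{n,r} = Σ_{I ⊔ J = [n], |I| = r} ( ∏_{j ∈ J, i ≠ j} [αᵢ,αⱼ] · ∏_{i ∈ I, k} [βₖ,αᵢ] )`,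
where `f_n = ∏ᵢ (α_{i,0}x - α_{i,1}y)` and `f_{n-2} = ∏ₖ (β_{k,0}x - β_{k,1}y)`. -/
theorem DR_eq_bracket_sum {k : Type*} [Field k] [IsAlgClosed k] [CharZero k]
    (n r : ℕ) (hn : 2 ≤ n) (hr : r ≤ n) (hne : ¬(n = 2 ∧ r = 2))
    (α : Fin n → Fin 2 → k) (β : Fin (n - 2) → Fin 2 → k) (p q : Polynomial k)
    (hp : p = ∏ i, (C (α i 0) * X - C (α i 1)))
    (hq : q = ∏ j, (C (β j 0) * X - C (β j 1)))
    (ha : p.coeff 0 * p.coeff n ≠ 0) :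
    DR n r p q =
      ∑ I ∈ Finset.powersetCard r (Finset.univ : Finset (Fin n)),
        ((∏ j ∈ Iᶜ, ∏ i ∈ Finset.univ.erase j, bracket (α i) (α j)) *
          ∏ i ∈ I, ∏ m : Fin (n - 2), bracket (β m) (α i)) := by
  have hcard : (Finset.univ : Finset (Fin n)).card = n := by simp
  have hcoeffn : p.coeff n = ∏ i, α i 0 := by
    have := coeff_prod_of_natDegree_le (fun i => C (α i 0) * X - C (α i 1)) 1
      (s := (Finset.univ : Finset (Fin n))) fun i _ => by compute_degree
    rw [hcard, mul_one] at this
    rw [hp, this]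
    simp [coeff_C]
  have hcoeff0 : p.coeff 0 = (-1) ^ n * ∏ i, α i 1 := by
    rw [hp, coeff_zero_eq_eval_zero, eval_prod]
    simp [Finset.prod_neg]
  have hα (i : Fin n) : α i 0 ≠ 0 := by
    have := right_ne_zero_of_mul ha
    rw [hcoeffn] at this
    exact Finset.prod_ne_zero_iff.mp this i (Finset.mem_univ i)
  have hpdeg : p.natDegree ≤ n := by
    rw [hp]
    refine (natDegree_prod_le _ _).trans ((Finset.sum_le_card_nsmul _ _ 1 fun i _ => ?_).trans ?_)
    · compute_degree
    · simp
  have hqdeg : q.natDegree ≤ n - 2 := by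
    rw [hq]
    refine (natDegree_prod_le _ _).trans ((Finset.sum_le_card_nsmul _ _ 1 fun i _ => ?_).trans ?_)
    · compute_degree
    · simp
  have hpmap : p.map (C : k →+* k[X]) =
      ∏ i, C (C (α i 0)) * (X - C (C (α i 1 / α i 0))) := by
    rw [hp, Polynomial.map_prod]
    refine Finset.prod_congr rfl fun i _ => ?_
    rw [mul_sub, ← C_mul, ← C_mul, mul_div_cancel₀ _ (hα i)]
    simp
  have hgdeg : (X * (derivative p).map (C : k →+* k[X]) +
      C (X : k[X]) * X * q.map (C : k →+* k[X])).natDegree ≤ n := by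
    have h₁ : ((derivative p).map (C : k →+* k[X])).natDegree ≤ n - 1 :=
      natDegree_map_le.trans ((natDegree_derivative_le p).trans (by omega))
    have h₂ : (q.map (C : k →+* k[X])).natDegree ≤ n - 2 := natDegree_map_le.trans hqdeg
    refine natDegree_add_le_of_degree_le ?_ ?_
    · exact (natDegree_mul_le_of_le natDegree_X_le h₁).trans (by omega)
    · exact (natDegree_mul_le_of_le (m := 1) (by compute_degree) h₂).trans (by omega)
  have hfactor (j : Fin n) : C (α j 0) ^ n * (X * (derivative p).map (C : k →+* k[X]) +
      C (X : k[X]) * X * q.map (C : k →+* k[X])).eval (C (α j 1 / α j 0)) =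
      C (α j 0 * α j 1) * (C (∏ i ∈ Finset.univ.erase j, bracket (α i) (α j)) +
        X * C (∏ m : Fin (n - 2), bracket (β m) (α j))) := by
    have hd := pow_card_mul_eval_prod (Finset.univ.erase j) α (α j) (hα j)
    have hb := pow_card_mul_eval_prod Finset.univ β (α j) (hα j)
    have hder := eval_derivative_prod_linear Finset.univ α (Finset.mem_univ j) (hα j)
    rw [Finset.card_erase_of_mem (Finset.mem_univ j), hcard] at hd
    rw [← hq, Finset.card_univ, Fintype.card_fin] at hb
    rw [← hp] at hder
    rw [← hd, ← hb]
    simp only [eval_add, eval_mul, eval_X, eval_C, eval_map_apply, hder]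
    obtain ⟨l, rfl⟩ := Nat.exists_eq_add_of_le' hn
    have hξ : α j 1 = α j 0 * (α j 1 / α j 0) := (mul_div_cancel₀ _ (hα j)).symm
    generalize α j 1 / α j 0 = ξ at *
    rw [hξ]
    simp only [Nat.add_sub_cancel, Nat.add_succ_sub_one, C_mul, C_pow]
    ring
  have hnum : DRnum n p q = C (p.coeff 0 * p.coeff n) *
      ∏ j, (C (∏ i ∈ Finset.univ.erase j, bracket (α i) (α j)) +
        X * C (∏ m : Fin (n - 2), bracket (β m) (α j))) := by
    rw [DRnum, res_eq_resultant, hpmap, resultant_prod_C_mul_X_sub_C (fun i => C (α i 0))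
      (fun i => C (α i 1 / α i 0)) (fun i => C_ne_zero.mpr (hα i)) _ _ hgdeg]
    simp_rw [hfactor]
    have hsign : (-1 : k[X]) ^ (n * n) = (-1) ^ n := by
      rcases Nat.even_or_odd n with h | h
      · rw [(h.mul_right n).neg_one_pow, h.neg_one_pow]
      · rw [(h.mul h).neg_one_pow, h.neg_one_pow]
    rw [Finset.prod_mul_distrib, ← map_prod, Finset.prod_mul_distrib, hsign, hcoeff0, hcoeffn]
    simp only [C_mul, C_pow, C_neg, C_1]
    ring
  rw [DR, hnum, coeff_C_mul, mul_div_cancel_left₀ _ ha, coeff_prod_C_add_X_mul_C]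
end

section
/- For n ≥ 2, the discriminant-resultants {DR_{n,r} : r = 0, 2, 3, …, n}, viewed as polynomials in the coefficients of the generic binary forms f_n (of degree n) and f_{n−2} (of degree n−2), are algebraically independent over k. -/
open Polynomial Finset

theorem DRnum_map {R S : Type*} [CommRing R] [CommRing S] (φ : R →+* S) (n : ℕ) (p q : R[X]) :
    DRnum n (p.map φ) (q.map φ) = (DRnum n p q).map φ := by
  have hC (f : R[X]) : (f.map φ).map C = (f.map C).map (mapRingHom φ) := by
    rw [Polynomial.map_map, Polynomial.map_map, mapRingHom_comp_C]
  have key := resultant_map_map (p.map C)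
    (X * (derivative p).map C + C (X : R[X]) * X * q.map C) n n (mapRingHom φ)
  rw [coe_mapRingHom] at key
  rw [DRnum, DRnum, res_eq_resultant, res_eq_resultant, Polynomial.map_mul, ← key]
  rw [derivative_map, hC, hC, hC, Polynomial.map_add, Polynomial.map_mul, Polynomial.map_mul,
    Polynomial.map_mul, Polynomial.map_X, Polynomial.map_C, coe_mapRingHom, Polynomial.map_X]
  simp only [Polynomial.map_pow, Polynomial.map_neg, Polynomial.map_one]

theorem reflect_prod_X_add_C {R : Type*} [CommRing R] (n : ℕ) (u : ℕ → R) :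
    reflect n (∏ i ∈ range n, (X + C (u i))) = ∏ i ∈ range n, (1 + C (u i) * X) := by
  induction n with
  | zero => simp
  | succ n ih =>
    have hX : reflect 1 (X : R[X]) = 1 := by simp
    rw [prod_range_succ, prod_range_succ, reflect_mul, ih, reflect_add, hX, reflect_C, pow_one]
    · refine (natDegree_prod_le _ _).trans ?_
      refine (sum_le_card_nsmul _ _ 1 fun i _ => ?_).trans (by simp)
      exact natDegree_add_C.trans_le natDegree_X_le
    · exact natDegree_add_C.trans_le natDegree_X_le

theorem coeff_zero_prod_one_add_C_mul_X {R : Type*} [CommRing R] (n : ℕ) (u : ℕ → R) :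
    (∏ i ∈ range n, (1 + C (u i) * X)).coeff 0 = 1 := by
  simp [coeff_zero_prod]

theorem coeff_one_prod_one_add_C_mul_X {R : Type*} [CommRing R] (n : ℕ) (u : ℕ → R) :
    (∏ i ∈ range n, (1 + C (u i) * X)).coeff 1 = ∑ i ∈ range n, u i := by
  induction n with
  | zero => simp [coeff_one]
  | succ n ih =>
    rw [prod_range_succ, mul_add, mul_one, ← mul_assoc, coeff_add, coeff_mul_X, coeff_mul_C, ih,
      coeff_zero_prod_one_add_C_mul_X, one_mul, sum_range_succ]

theorem Polynomial.Monic.exists_eq_prod_X_add_C {K : Type*} [Field K] [IsAlgClosed K] {M : K[X]}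
    (hM : M.Monic) : ∃ u : ℕ → K, M = ∏ i ∈ range M.natDegree, (X + C (u i)) := by
  have hs := IsAlgClosed.splits M
  obtain ⟨L, hL⟩ : ∃ L : List K, (L : Multiset K) = M.roots := ⟨_, M.roots.coe_toList⟩
  have hlen : M.natDegree = L.length := by
    rw [hs.natDegree_eq_card_roots, ← hL, Multiset.coe_card]
  refine ⟨fun i => -L.getD i 0, ?_⟩
  conv_lhs => rw [hs.eq_prod_roots_of_monic hM, ← hL]
  rw [Multiset.map_coe, Multiset.prod_coe, hlen, Finset.prod_range,
    ← Fin.prod_univ_fun_getElem]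
  simp [sub_eq_add_neg]

theorem exists_coeff_prod_one_add_C_mul_X_eq {K : Type*} [Field K] [IsAlgClosed K] (n : ℕ)
    (c : ℕ → K) (hc : c 0 = 1) :
    ∃ u : ℕ → K, ∀ r ≤ n, (∏ i ∈ range n, (1 + C (u i) * X)).coeff r = c r := by
  set M : K[X] := X ^ n + ∑ j : Fin n, C (c (n - j)) * X ^ (j : ℕ) with hMdef
  have hdeg : (∑ j : Fin n, C (c (n - j)) * X ^ (j : ℕ)).degree < (n : WithBot ℕ) :=
    degree_sum_fin_lt _
  have hM : M.Monic := monic_X_pow_add hdeg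
  have hMn : M.natDegree = n := by
    rw [hMdef, natDegree_add_eq_left_of_degree_lt (by rwa [degree_X_pow]), natDegree_X_pow]
  obtain ⟨u, hu⟩ := hM.exists_eq_prod_X_add_C
  rw [hMn] at hu
  refine ⟨u, fun r hr => ?_⟩
  rw [← reflect_prod_X_add_C, ← hu, coeff_reflect, revAt_le hr, hMdef,
    ← Finset.sum_range fun j => C (c (n - j)) * (X : K[X]) ^ j]
  simp only [coeff_add, coeff_X_pow, finsetSum_coeff, coeff_C_mul, mul_ite, mul_one, mul_zero,
    sum_ite_eq, mem_range]
  rcases Nat.eq_zero_or_pos r with rfl | hr0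
  · simp [hc]
  · rw [if_neg (by lia), if_pos (by lia), zero_add, Nat.sub_sub_self hr]

/-- Fractions with common denominator `h` are algebraically independent once no nonzero polynomial
vanishes at all of their specializations in `K` with `h` not mapped to `0`. -/
theorem algebraicIndependent_div_of_specialization {k R F K ι : Type*} [Field k] [CommRing R]
    [IsDomain R] [Algebra k R] [Field F] [Algebra R F] [IsFractionRing R F] [Algebra k F]
    [IsScalarTower k R F] [Field K] [Algebra k K] (h : R) (hh : h ≠ 0) (N : ι → R)
    (H : ∀ P : MvPolynomial ι k, P ≠ 0 →
      ∃ v : R →ₐ[k] K, v h ≠ 0 ∧ MvPolynomial.aeval (fun i => v (N i) / v h) P ≠ 0) :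
    AlgebraicIndependent k (fun i => algebraMap R F (N i) / algebraMap R F h) := by
  rw [algebraicIndependent_iff]
  intro P hP
  by_contra hP0
  obtain ⟨v, hv, hPv⟩ := H P hP0
  let S := Localization.Away h
  let φ : S →ₐ[k] F := IsLocalization.Away.liftAlgHom h (f := IsScalarTower.toAlgHom k R F)
    (by simpa using hh)
  let ψ : S →ₐ[k] K := IsLocalization.Away.liftAlgHom h (f := v) (isUnit_iff_ne_zero.mpr hv)
  have hφ : ∀ x, φ (algebraMap R S x) = algebraMap R F x := fun x => by simp [φ]
  have hψ : ∀ x, ψ (algebraMap R S x) = v x := fun x => by simp [ψ]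
  have hφinj : Function.Injective φ := by
    refine (IsLocalization.lift_injective_iff _).mpr fun x y => ?_
    rw [(IsLocalization.injective S (powers_le_nonZeroDivisors_of_noZeroDivisors hh)).eq_iff]
    exact (IsFractionRing.injective R F).eq_iff.symm
  let a : ι → S := fun i => algebraMap R S (N i) * IsLocalization.Away.invSelf h
  have hinv : algebraMap R S h * IsLocalization.Away.invSelf h = 1 :=
    IsLocalization.Away.mul_invSelf h
  have haφ : ∀ i, φ (a i) = algebraMap R F (N i) / algebraMap R F h := fun i => by
    have := congrArg φ hinv
    rw [map_mul, hφ, map_one] at this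
    rw [map_mul, hφ, div_eq_mul_inv, eq_inv_of_mul_eq_one_right this]
  have haψ : ∀ i, ψ (a i) = v (N i) / v h := fun i => by
    have := congrArg ψ hinv
    rw [map_mul, hψ, map_one] at this
    rw [map_mul, hψ, div_eq_mul_inv, eq_inv_of_mul_eq_one_right this]
  have ha : MvPolynomial.aeval a P = 0 := by
    apply hφinj
    rw [map_zero, ← hP, ← AlgHom.comp_apply, MvPolynomial.comp_aeval]
    simp only [haφ]
  apply hPv
  simp only [← haψ]
  rw [← MvPolynomial.comp_aeval, AlgHom.comp_apply, ha, map_zero]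

theorem IsPrimitiveRoot.X_pow_sub_one_eq_prod_range {K : Type*} [Field K] {n : ℕ} {ω : K}
    (hω : IsPrimitiveRoot ω n) (hn : 0 < n) :
    (X ^ n - 1 : K[X]) = ∏ i ∈ range n, (X - C (ω ^ i)) := by
  classical
  rw [X_pow_sub_one_eq_prod hn hω, nthRootsFinset, ← Multiset.toFinset_eq hω.nthRoots_one_nodup]
  simp only [Finset.prod_mk, hω.nthRoots_eq (one_pow n), mul_one, Multiset.map_map]
  rfl

theorem DRnum_C_mul_X_pow_sub_one {K : Type*} [Field K] {n : ℕ} (hn : 0 < n) {ω : K}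
    (hω : IsPrimitiveRoot ω n) (s : K) (q : K[X]) (hq : q.natDegree + 1 ≤ n) :
    DRnum n (C s * (X ^ n - 1)) q =
      C ((-1) ^ (n * n) * s ^ n) *
        ∏ i ∈ range n, (C (s * n) + C (ω ^ i * q.eval (ω ^ i)) * X) := by
  have hmap : ((C s * (X ^ n - 1) : K[X]).map (C : K →+* K[X])) =
      C (C s) * ∏ i ∈ range n, (X - C (C (ω ^ i))) := by
    rw [hω.X_pow_sub_one_eq_prod_range hn]
    simp [Polynomial.map_prod]
  have hdeg : (∏ i ∈ range n, (X - C (C (ω ^ i))) : K[X][X]).natDegree = n := by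
    rw [natDegree_finsetProd_X_sub_C_eq_card, card_range]
  set g : K[X][X] := X * (derivative (C s * (X ^ n - 1))).map C + C X * X * q.map C with hg
  have hgdeg : g.natDegree ≤ n := by
    refine natDegree_add_le_of_degree_le ?_ ?_
    · refine natDegree_mul_le_of_le natDegree_X_le (natDegree_map_le.trans ?_) |>.trans
        (by lia : 1 + (n - 1) ≤ n)
      refine (natDegree_derivative_le _).trans ?_
      refine Nat.sub_le_sub_right ((natDegree_C_mul_le _ _).trans ?_) 1
      exact natDegree_X_pow_sub_C.le
    · rw [mul_assoc]
      refine (natDegree_C_mul_le _ _).trans ?_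
      exact (natDegree_mul_le_of_le natDegree_X_le natDegree_map_le).trans (by lia)
  have hev (i : ℕ) : g.eval (C (ω ^ i)) = C (s * n) + C (ω ^ i * q.eval (ω ^ i)) * X := by
    have h1 : ω ^ i * (ω ^ i) ^ (n - 1) = 1 := by
      rw [← pow_succ', Nat.sub_add_cancel hn, pow_right_comm, hω.pow_eq_one, one_pow]
    have h2 : s * n = ω ^ i * (derivative (C s * (X ^ n - 1))).eval (ω ^ i) := by
      simp only [derivative_C_mul, derivative_sub, derivative_X_pow, derivative_one, sub_zero,
        eval_mul, eval_C, eval_pow, eval_X]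
      linear_combination (-s * n) * h1
    rw [h2, hg]
    simp only [eval_add, eval_mul, eval_X, eval_C, eval_map, eval₂_at_apply, C_mul]
    ring
  have hres : resultant (∏ i ∈ range n, (X - C (C (ω ^ i)))) g n n =
      ∏ i ∈ range n, g.eval (C (ω ^ i)) := by
    have := resultant_prod_left (range n) (fun i => (X - C (C (ω ^ i)) : K[X][X])) g n
      (by simp only [leadingCoeff_X_sub_C, prod_const_one]; exact one_ne_zero) hgdeg
    rw [hdeg] at this
    rw [this]
    exact prod_congr rfl fun i _ => by
      rw [natDegree_X_sub_C, resultant_X_sub_C_left _ _ _ hgdeg]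
  rw [DRnum, res_eq_resultant, hmap, resultant_C_mul_left, hres, prod_congr rfl fun i _ => hev i]
  simp [mul_assoc]

theorem IsPrimitiveRoot.sum_eval_pow {K : Type*} [Field K] {n : ℕ} {ω : K}
    (hω : IsPrimitiveRoot ω n) (h : K[X]) (hh : h.natDegree < n) :
    ∑ i ∈ range n, h.eval (ω ^ i) = n * h.coeff 0 := by
  simp_rw [eval_eq_sum_range' hh]
  rw [sum_comm, sum_eq_single 0]
  · simp
  · intro j hj hj0
    have h1 : ω ^ j ≠ 1 := hω.pow_ne_one_of_pos_of_lt hj0 (mem_range.mp hj)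
    have h2 : ∑ i ∈ range n, (ω ^ j) ^ i = 0 := by
      rw [geom_sum_eq h1, pow_right_comm, hω.pow_eq_one]
      simp
    simp_rw [← mul_sum, pow_right_comm ω _ j, h2, mul_zero]
  · intro h0
    simp at h0
    lia

/-- Every tuple of values with `c 0 ≠ 0` and `c 1 = 0` is attained by the discriminant-resultants of
a multiple of `x ^ n - y ^ n` and a suitable interpolating form. -/
theorem exists_DR_eq {K : Type*} [Field K] [IsAlgClosed K] [CharZero K] {n : ℕ} (hn : 2 ≤ n)
    (c : ℕ → K) (hc0 : c 0 ≠ 0) (hc1 : c 1 = 0) :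
    ∃ p q : K[X], p.natDegree < n + 1 ∧ q.natDegree < n - 1 ∧ p.coeff 0 * p.coeff n ≠ 0 ∧
      ∀ r ≤ n, DR n r p q = c r := by
  have hnK : (n : K) ≠ 0 := by exact_mod_cast (by lia : n ≠ 0)
  have : NeZero (n : K) := ⟨hnK⟩
  have : NeZero n := ⟨by lia⟩
  obtain ⟨ω, hω⟩ := HasEnoughRootsOfUnity.exists_primitiveRoot K n
  obtain ⟨u, hu⟩ := exists_coeff_prod_one_add_C_mul_X_eq n (fun r => c r / c 0) (div_self hc0)
  have husum : ∑ i ∈ range n, u i = 0 := by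
    rw [← coeff_one_prod_one_add_C_mul_X, hu 1 (by lia), hc1, zero_div]
  obtain ⟨s, hs⟩ := IsAlgClosed.exists_pow_nat_eq
    (-((-1) ^ (n * n) * c 0 / (n : K) ^ n)) (show 0 < 2 * n - 2 by lia)
  have hs0 : s ≠ 0 := by
    rintro rfl
    rw [zero_pow (by lia)] at hs
    simp [hc0, hnK] at hs
  have hinj : Set.InjOn (fun i => ω ^ i) (range n : Set ℕ) := by
    intro i hi j hj hij
    exact hω.pow_inj (by simpa using hi) (by simpa using hj) hij
  set h := Lagrange.interpolate (range n) (fun i => ω ^ i) (fun i => s * n * u i) with hh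
  have hev : ∀ i ∈ range n, h.eval (ω ^ i) = s * n * u i := fun i hi =>
    Lagrange.eval_interpolate_at_node _ hinj hi
  have hdeg : h.natDegree < n := by
    by_cases h0 : h = 0
    · simp [h0]; lia
    · have := Lagrange.degree_interpolate_lt (fun i => s * n * u i) hinj
      rwa [card_range, ← hh, ← natDegree_lt_iff_degree_lt h0] at this
  have hcoeff : h.coeff 0 = 0 := by
    have := hω.sum_eval_pow h hdeg
    rw [sum_congr rfl hev, ← mul_sum, husum, mul_zero] at this
    simpa [hnK] using this.symm
  have hX : X * h.divX = h := by
    conv_rhs => rw [← X_mul_divX_add h, hcoeff, C_0, add_zero]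
  have hp0 : (C s * (X ^ n - 1)).coeff 0 = -s := by
    simp [coeff_X_pow, (by lia : 0 ≠ n)]
  have hpn : (C s * (X ^ n - 1)).coeff n = s := by
    simp [coeff_one, (by lia : n ≠ 0)]
  refine ⟨C s * (X ^ n - 1), h.divX, ?_, ?_, ?_, fun r hr => ?_⟩
  · refine Nat.lt_succ_of_le ((natDegree_C_mul_le _ _).trans ?_)
    exact natDegree_X_pow_sub_C.le
  · rw [natDegree_divX_eq_natDegree_tsub_one]; lia
  · rw [hp0, hpn]; simp [hs0]
  · rw [DR, DRnum_C_mul_X_pow_sub_one (by lia) hω s _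
      (by rw [natDegree_divX_eq_natDegree_tsub_one]; lia), hp0, hpn]
    have hfac : ∀ i ∈ range n, C (s * n) + C (ω ^ i * h.divX.eval (ω ^ i)) * X =
        C (s * n) * (1 + C (u i) * X) := fun i hi => by
      have : ω ^ i * h.divX.eval (ω ^ i) = s * n * u i := by
        rw [← hev i hi]
        conv_rhs => rw [← hX]
        simp
      rw [this, C_mul (a := s * n)]; ring
    rw [prod_congr rfl hfac, prod_mul_distrib, prod_const, card_range, ← C_pow, ← mul_assoc,
      ← C_mul, coeff_C_mul, hu r hr]
    have hsn : s ^ n * s ^ n = s ^ (2 * n - 2) * (s * s) := by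
      rw [← pow_add, ← pow_two, ← pow_add]; congr 1; lia
    have hsign : ((-1 : K) ^ (n * n)) * (-1) ^ (n * n) = 1 := by
      rw [← mul_pow]; simp
    rw [div_eq_iff (by simp [hs0]), mul_pow]
    have : (-1) ^ (n * n) * s ^ n * (s ^ n * (n : K) ^ n) = -(c 0) * (s * s) := by
      rw [show (-1) ^ (n * n) * s ^ n * (s ^ n * (n : K) ^ n) =
        (-1) ^ (n * n) * (s ^ n * s ^ n) * (n : K) ^ n by ring, hsn, hs]
      field_simp
      linear_combination -hsign
    rw [this]
    field_simp

theorem coeff_sum_fin_C_mul_X_pow {R : Type*} [CommRing R] {m : ℕ} (a : Fin m → R) (i : Fin m) :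
    (∑ j : Fin m, C (a j) * X ^ (j : ℕ)).coeff i = a i := by
  simp [finsetSum_coeff, coeff_X_pow, Fin.val_inj]

/-- The discriminant-resultants `{DR_{n,r} : r = 0, 2, 3, …, n}`, viewed as functions of
the coefficients `a₀,…,aₙ, b₀,…,b_{n-2}` of the generic binary forms
`f_n = Σ aᵢ xⁱ y^{n-i}` and `f_{n-2} = Σ bᵢ xⁱ y^{n-2-i}` (independent indeterminates,
working in the fraction field so that division by `a₀aₙ` is allowed), are algebraically
independent over `k`. -/
theorem DR_algebraicallyIndependent {k : Type*} [Field k] [CharZero k] (n : ℕ)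
    (hn : 2 ≤ n) :
    AlgebraicIndependent k
      (fun r : {r : ℕ // r ≤ n ∧ r ≠ 1} =>
        DR n r.1
          (∑ i : Fin (n + 1),
            Polynomial.C
              (algebraMap (MvPolynomial (Fin (n + 1) ⊕ Fin (n - 1)) k)
                (FractionRing (MvPolynomial (Fin (n + 1) ⊕ Fin (n - 1)) k))
                (MvPolynomial.X (Sum.inl i))) * Polynomial.X ^ (i : ℕ))
          (∑ i : Fin (n - 1),
            Polynomial.C
              (algebraMap (MvPolynomial (Fin (n + 1) ⊕ Fin (n - 1)) k)
                (FractionRing (MvPolynomial (Fin (n + 1) ⊕ Fin (n - 1)) k))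
                (MvPolynomial.X (Sum.inr i))) * Polynomial.X ^ (i : ℕ))) := by
  let R := MvPolynomial (Fin (n + 1) ⊕ Fin (n - 1)) k
  let K := AlgebraicClosure k
  set p : R[X] := ∑ i : Fin (n + 1), C (MvPolynomial.X (Sum.inl i)) * X ^ (i : ℕ) with hp
  set q : R[X] := ∑ i : Fin (n - 1), C (MvPolynomial.X (Sum.inr i)) * X ^ (i : ℕ) with hq
  have hp0 : p.coeff 0 = MvPolynomial.X (Sum.inl 0) :=
    coeff_sum_fin_C_mul_X_pow (fun i => (MvPolynomial.X (Sum.inl i) : R)) 0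
  have hpn : p.coeff n = MvPolynomial.X (Sum.inl (Fin.last n)) :=
    coeff_sum_fin_C_mul_X_pow (fun i => (MvPolynomial.X (Sum.inl i) : R)) (Fin.last n)
  have key : AlgebraicIndependent k (fun r : {r : ℕ // r ≤ n ∧ r ≠ 1} =>
      algebraMap R (FractionRing R) ((DRnum n p q).coeff r) /
        algebraMap R (FractionRing R) (p.coeff 0 * p.coeff n)) := by
    refine algebraicIndependent_div_of_specialization (K := K) _ ?_ _ fun P hP => ?_
    · rw [hp0, hpn]
      exact mul_ne_zero (MvPolynomial.X_ne_zero _) (MvPolynomial.X_ne_zero _)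
    let z : {r : ℕ // r ≤ n ∧ r ≠ 1} := ⟨0, by lia⟩
    obtain ⟨c, hc⟩ : ∃ c, MvPolynomial.eval c (MvPolynomial.X z * P) ≠ 0 := by
      by_contra! hzero
      exact mul_ne_zero (MvPolynomial.X_ne_zero z) hP (MvPolynomial.funext (by simpa using hzero))
    rw [map_mul, MvPolynomial.eval_X] at hc
    obtain ⟨hcz, hcP⟩ := mul_ne_zero_iff.mp hc
    obtain ⟨p', q', hp', hq', hne, hDR⟩ := exists_DR_eq (K := K) hn
      (fun r => if h : r ≤ n ∧ r ≠ 1 then algebraMap k K (c ⟨r, h⟩) else 0)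
      (by simpa [z] using hcz) (by simp)
    let v : R →ₐ[k] K := MvPolynomial.aeval
      (Sum.elim (fun i => p'.coeff i) (fun i => q'.coeff i))
    have hvX (j) : v (MvPolynomial.X j) = Sum.elim (fun i : Fin (n + 1) => p'.coeff i)
        (fun i : Fin (n - 1) => q'.coeff i) j := MvPolynomial.aeval_X _ j
    have hvp : p.map (v : R →+* K) = p' := by
      rw [p'.as_sum_range' _ hp', Finset.sum_range, hp]
      simp [Polynomial.map_sum, hvX, C_mul_X_pow_eq_monomial]
    have hvq : q.map (v : R →+* K) = q' := by
      rw [q'.as_sum_range' _ hq', Finset.sum_range, hq]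
      simp [Polynomial.map_sum, hvX, C_mul_X_pow_eq_monomial]
    have hva : v (p.coeff 0 * p.coeff n) = p'.coeff 0 * p'.coeff n := by
      simp [← hvp]
    refine ⟨v, hva ▸ hne, ?_⟩
    have hval : (fun r : {r : ℕ // r ≤ n ∧ r ≠ 1} =>
        v ((DRnum n p q).coeff r) / v (p.coeff 0 * p.coeff n)) =
        algebraMap k K ∘ c := by
      funext r
      have := hDR r r.2.1
      rw [dif_pos r.2, DR, ← hva, ← hvp, ← hvq, DRnum_map, coeff_map] at this
      exact this
    rw [hval, MvPolynomial.aeval_algebraMap_apply]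
    simpa using hcP
  convert key using 2 with r
  rw [DR, map_mul]
  have hpF : ∑ i : Fin (n + 1), C (algebraMap R (FractionRing R) (MvPolynomial.X (Sum.inl i))) *
      X ^ (i : ℕ) = p.map (algebraMap R (FractionRing R)) := by
    simp [hp, Polynomial.map_sum]
  have hqF : ∑ i : Fin (n - 1), C (algebraMap R (FractionRing R) (MvPolynomial.X (Sum.inr i))) *
      X ^ (i : ℕ) = q.map (algebraMap R (FractionRing R)) := by
    simp [hq, Polynomial.map_sum]
  rw [hpF, hqF, DRnum_map, coeff_map, coeff_map, coeff_map]
end
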